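/- Assume Hypothesis (H) and additionally deg_x(P) ≤ d_x; set f = P/Q, write Q = t(y)·T(x,y) with t the content and T the primitive part of Q with respect to x, and let T* be the squarefree part of T with respect to y. Let ρ be the minimal order of a telescoper for f (so ρ ≤ d_y*), and put n_x = d_x + ρ·deg_x(T*) and β = d_y^- + ρ·deg_y(T*). Then there exist a minimal telescoper L = Σ_{i=0}^{ρ} η_i·D_x^i with coefficients η_i in k[x] of degree at most n_x·(ρ+1) + d_x·(β+1), and a certificate g for L of the form g = z/(Q^-·(T*)^{ρ}) with z in k[x,y], deg_x(z) ≤ n_x·(ρ+1) + d_x·(β+1), and deg_y(z) ≤ β. -/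

import Mathlib

open Polynomial

noncomputable section

/-- A map is a derivation: it is additive and satisfies the Leibniz rule. -/
def IsDeriv {F : Type*} [CommRing F] (D : F → F) : Prop :=
  (∀ a b, D (a + b) = D a + D b) ∧ ∀ a b, D (a * b) = a * D b + b * D a

/-- Degree in `x` of an element of `k[x][y]` (inner variable `x`, outer variable `y`). -/
def degX {k : Type*} [Field k] (Q : Polynomial (Polynomial k)) : ℕ :=
  Q.support.sup fun i => (Q.coeff i).natDegree

/-- Partial derivative with respect to `x` on `k[x][y]`. -/
def derivX {k : Type*} [Field k] (Q : Polynomial (Polynomial k)) : Polynomial (Polynomial k) :=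
  Q.sum fun i a => Polynomial.C (Polynomial.derivative a) * Polynomial.X ^ i

/-- The embedding `k[x][y] → k(x)(y)`. -/
def toF {k : Type*} [Field k] : Polynomial (Polynomial k) →+* RatFunc (RatFunc k) :=
  (algebraMap (Polynomial (RatFunc k)) (RatFunc (RatFunc k))).comp
    (Polynomial.mapRingHom (algebraMap (Polynomial k) (RatFunc k)))

/-- The embedding `k(x) → k(x)(y)`. -/
def ratToF {k : Type*} [Field k] : RatFunc k →+* RatFunc (RatFunc k) :=
  (algebraMap (Polynomial (RatFunc k)) (RatFunc (RatFunc k))).comp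
    (Polynomial.C : RatFunc k →+* Polynomial (RatFunc k))

/-- The embedding `k(x)[y] → k(x)(y)`. -/
def kyToF {k : Type*} [Field k] : Polynomial (RatFunc k) →+* RatFunc (RatFunc k) :=
  algebraMap (Polynomial (RatFunc k)) (RatFunc (RatFunc k))

/-- The embedding `k[x][y] → k(x)[y]`. -/
def toKy {k : Type*} [Field k] : Polynomial (Polynomial k) →+* Polynomial (RatFunc k) :=
  Polynomial.mapRingHom (algebraMap (Polynomial k) (RatFunc k))

/-- The embedding `k[y] → k[x][y]` (a polynomial in `y` viewed in `k[x][y]`). -/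
def yToXY {k : Type*} [Field k] : Polynomial k →+* Polynomial (Polynomial k) :=
  Polynomial.mapRingHom (Polynomial.C : k →+* Polynomial k)

/-- The Hermite matrix associated with a factorisation `Q = Qs * Qneg`, with respect to the
monomial bases: its columns are the coefficient vectors (in `y`, coefficients in `k[x]`) of
`Qs * D_y(y^j) - E * y^j` for `j < dm` (where `E = Qs * D_y(Qneg) / Qneg`) and of
`Qneg * y^j` for `j < dy - dm`. -/
def hermiteMat {k : Type*} [Field k] (Qs Qneg E : Polynomial (Polynomial k)) (dy dm : ℕ) :
    Matrix (Fin dy) (Fin dy) (Polynomial k) :=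
  Matrix.of fun i j =>
    if (j : ℕ) < dm then
      (Qs * Polynomial.derivative (Polynomial.X ^ (j : ℕ)) - E * Polynomial.X ^ (j : ℕ)).coeff i
    else
      (Qneg * Polynomial.X ^ ((j : ℕ) - dm)).coeff i


lemma aux_dvd {K : Type*} [Field K] [CharZero K] (A B N S W : K[X]) (hB : B ≠ 0)
    (hcop : IsCoprime A B) (hS : Squarefree S)
    (h : (S * W) * (derivative A * B - A * derivative B) = N * B ^ 2) : B ∣ W := by
  rw [UniqueFactorizationMonoid.dvd_iff_emultiplicity_le hB]
  intro p hp
  by_cases hpB : p ∣ B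
  swap
  · rw [emultiplicity_eq_zero.2 hpB]; exact zero_le
  have hfin : FiniteMultiplicity p B := FiniteMultiplicity.of_prime_left hp hB
  obtain ⟨c, hc, hpc⟩ := hfin.exists_eq_pow_mul_and_not_dvd
  rw [hfin.emultiplicity_eq_multiplicity]
  have he0 : multiplicity p B ≠ 0 := by
    intro h0
    exact (multiplicity_ne_zero.2 hpB) h0
  obtain ⟨e, he⟩ := Nat.exists_eq_succ_of_ne_zero he0
  rw [he] at hc ⊢
  apply le_emultiplicity_of_pow_dvd
  have hpA : ¬ p ∣ A := fun hA => hp.not_isUnit (hcop.isUnit_of_dvd' hA hpB)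
  have hpp : ¬ p ∣ derivative p := by
    intro hd
    have hdeg : 0 < p.natDegree := hp.irreducible.natDegree_pos
    have hne : derivative p ≠ 0 := by
      intro h0
      have := derivative_eq_zero.1 h0
      omega
    have h1 := natDegree_le_of_dvd hd hne
    have h2 := natDegree_derivative_lt (p := p) (by omega)
    omega
  set Y : K[X] := p * (derivative A * c - A * derivative c) - C ((e:K) + 1) * (A * (derivative p * c)) with hY
  have hpY : ¬ p ∣ Y := by
    intro hd
    have h1 : p ∣ C ((e:K) + 1) * (A * (derivative p * c)) :=
      (dvd_sub_right (Dvd.intro _ rfl)).1 hd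
    have hu : IsUnit (C ((e:K) + 1)) := by
      rw [isUnit_C, isUnit_iff_ne_zero]; exact Nat.cast_add_one_ne_zero e
    rw [hu.dvd_mul_left] at h1
    rcases hp.dvd_or_dvd h1 with h1 | h1
    · exact hpA h1
    · rcases hp.dvd_or_dvd h1 with h1 | h1
      · exact hpp h1
      · exact hpc h1
  have key : (S * W) * Y = p ^ (e + 2) * (N * c ^ 2) := by
    have hpe : p ^ e ≠ 0 := pow_ne_zero _ hp.ne_zero
    apply mul_left_cancel₀ hpe
    have hBd : derivative B = p ^ e * (C ((e:K) + 1) * (derivative p * c) + p * derivative c) := by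
      rw [hc, derivative_mul, derivative_pow]
      simp only [Nat.succ_eq_add_one, Nat.add_sub_cancel, Nat.cast_add, Nat.cast_one, map_add, map_one, map_natCast]
      ring
    rw [hBd] at h
    rw [hc] at h
    rw [hY]
    simp only [Nat.succ_eq_add_one] at h
    linear_combination h
  have h1 : p ^ (e + 2) ∣ S * W :=
    hp.pow_dvd_of_dvd_mul_right _ hpY (key ▸ Dvd.intro _ rfl)
  by_cases hpS : p ∣ S
  · obtain ⟨R, rfl⟩ := hpS
    have hpR : ¬ p ∣ R := by
      rintro ⟨R', rfl⟩
      exact hp.not_isUnit (hS p ⟨R', by ring⟩)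
    have h2 : p ^ (e + 1) ∣ R * W := by
      obtain ⟨u, hu⟩ := h1
      refine ⟨u, mul_left_cancel₀ hp.ne_zero ?_⟩
      linear_combination hu
    exact hp.pow_dvd_of_dvd_mul_left _ hpR h2
  · exact (pow_dvd_pow p (by simp)).trans (hp.pow_dvd_of_dvd_mul_left _ hpS h1)

lemma aux_deg {K : Type*} [Field K] [CharZero K] (A B N D : K[X]) (hB : B ≠ 0)
    (hD : N.degree < D.degree)
    (h : D * (derivative A * B - A * derivative B) = N * B ^ 2) : A.natDegree ≤ B.natDegree := by
  by_contra! hlt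
  have hA0 : A ≠ 0 := by rintro rfl; simp at hlt
  have hD0 : D ≠ 0 := by rintro rfl; simp at hD
  obtain ⟨a, ha⟩ : ∃ a, A.natDegree = a + 1 := ⟨A.natDegree - 1, by omega⟩
  set b := B.natDegree with hb
  have hco : (derivative A * B - A * derivative B).coeff (a + b) ≠ 0 := by
    have h1 : (derivative A * B).coeff (a + b) = (a + 1) * A.leadingCoeff * B.leadingCoeff := by
      rw [coeff_mul_add_eq_of_natDegree_le (by have := natDegree_derivative_le A; omega) hb.ge,
        coeff_derivative, leadingCoeff, leadingCoeff, ha]; ring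
    have h2 : (A * derivative B).coeff (a + b) = b * A.leadingCoeff * B.leadingCoeff := by
      rcases Nat.eq_zero_or_pos b with h0 | h0
      · have : derivative B = 0 := derivative_of_natDegree_zero (by omega)
        simp [this, h0]
      · obtain ⟨b', hb'⟩ : ∃ b', b = b' + 1 := ⟨b - 1, by omega⟩
        have : a + b = (a + 1) + b' := by omega
        rw [this, coeff_mul_add_eq_of_natDegree_le ha.le (by have := natDegree_derivative_le B; omega),
          coeff_derivative, leadingCoeff, leadingCoeff, ha, ← hb, hb']
        push_cast; ring
    rw [coeff_sub, h1, h2]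
    have : ((a:K) + 1) * A.leadingCoeff * B.leadingCoeff - b * A.leadingCoeff * B.leadingCoeff
      = ((a + 1 - b : ℤ) : K) * (A.leadingCoeff * B.leadingCoeff) := by push_cast; ring
    rw [this]
    refine mul_ne_zero ?_ (mul_ne_zero (leadingCoeff_ne_zero.2 hA0) (leadingCoeff_ne_zero.2 hB))
    rw [Int.cast_ne_zero]; omega
  have hX0 : derivative A * B - A * derivative B ≠ 0 := by
    intro h0; rw [h0] at hco; simp at hco
  have hle := le_natDegree_of_ne_zero hco
  have hN0 : N ≠ 0 := by
    rintro rfl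
    rw [zero_mul] at h
    exact mul_ne_zero hD0 hX0 h
  have h3 := congrArg natDegree h
  rw [natDegree_mul hD0 hX0, natDegree_mul hN0 (pow_ne_zero _ hB), natDegree_pow] at h3
  have := natDegree_lt_natDegree hN0 hD
  omega

lemma aux_form {K : Type*} [Field K] [CharZero K] (A B N S W : K[X]) (hB : B ≠ 0) (hW : W ≠ 0)
    (hcop : IsCoprime A B) (hS : Squarefree S) (hD : N.degree < (S * W).degree)
    (h : (S * W) * (derivative A * B - A * derivative B) = N * B ^ 2) :
    ∃ z : K[X], z.natDegree ≤ W.natDegree ∧ z * B = A * W := by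
  have hdeg := aux_deg A B N _ hB hD h
  obtain ⟨V, hV⟩ := aux_dvd A B N S W hB hcop hS h
  refine ⟨A * V, ?_, by rw [hV]; ring⟩
  have hV0 : V ≠ 0 := by rintro rfl; simp at hV; exact hW hV
  rw [hV, natDegree_mul hB hV0]
  exact natDegree_mul_le.trans (by omega)

lemma aux_sqf {k : Type*} [Field k] (S : k[X][X]) (hS : Squarefree S) :
    Squarefree (S.map (algebraMap k[X] (RatFunc k))) := by
  classical
  letI : NormalizedGCDMonoid k[X] := Classical.choice inferInstance
  have hS0 : S ≠ 0 := hS.ne_zero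
  have hinj : Function.Injective (algebraMap k[X] (RatFunc k)) := IsFractionRing.injective _ _
  have hM0 : S.map (algebraMap k[X] (RatFunc k)) ≠ 0 := by
    rwa [Ne, Polynomial.map_eq_zero_iff hinj]
  intro p hpp
  have hp0 : p ≠ 0 := by
    rintro rfl
    rw [zero_mul, zero_dvd_iff] at hpp
    exact hM0 hpp
  obtain ⟨b, hb0, hb⟩ := IsLocalization.integerNormalization_spec (nonZeroDivisors k[X]) p
  set r := IsLocalization.integerNormalization (nonZeroDivisors k[X]) p with hr
  have hbne : algebraMap k[X] (RatFunc k) b ≠ 0 := by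
    rw [Ne, map_eq_zero_iff _ hinj]; exact nonZeroDivisors.ne_zero hb0
  have hr0 : r ≠ 0 := by
    intro h0
    rw [h0] at hb
    simp only [Polynomial.map_zero] at hb
    rw [algebra_compatible_smul (RatFunc k) b p, eq_comm, smul_eq_zero] at hb
    exact hb.elim hbne hp0
  have hcont := r.eq_C_content_mul_primPart
  have hc0 : algebraMap k[X] (RatFunc k) r.content ≠ 0 := by
    rw [Ne, map_eq_zero_iff _ hinj, content_eq_zero_iff]; exact hr0
  have hb2 : (C (algebraMap k[X] (RatFunc k) b)) * p =
      C (algebraMap k[X] (RatFunc k) r.content) * r.primPart.map (algebraMap k[X] (RatFunc k)) := by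
    rw [← smul_eq_C_mul, algebraMap_smul, ← hb]
    conv_lhs => rw [hcont]
    simp
  have hass : Associated p (r.primPart.map (algebraMap k[X] (RatFunc k))) := by
    have h1 : Associated p (C (algebraMap k[X] (RatFunc k) b) * p) :=
      (associated_unit_mul_left p _ (isUnit_C.2 hbne.isUnit)).symm
    rw [hb2] at h1
    exact h1.trans (associated_unit_mul_left _ _ (isUnit_C.2 hc0.isUnit))
  have hprim := r.isPrimitive_primPart
  have hd : r.primPart * r.primPart ∣ S := by
    apply (hprim.mul hprim).dvd_of_fraction_map_dvd_fraction_map (K := RatFunc k)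
    rw [Polynomial.map_mul]
    exact (hass.mul_mul hass).symm.dvd.trans hpp
  exact hass.symm.isUnit ((hS _ hd).map (mapRingHom (algebraMap k[X] (RatFunc k))))

lemma aux_det_deg {k : Type*} [Field k] {ι : Type*} [Fintype ι] [DecidableEq ι]
    (M : Matrix ι ι k[X]) (c : ι → ℕ) (hc : ∀ i j, (M i j).natDegree ≤ c j) :
    M.det.natDegree ≤ ∑ j, c j := by
  rw [Matrix.det_apply]
  apply natDegree_sum_le_of_forall_le
  intro σ _
  refine (natDegree_smul_le _ _).trans ?_
  refine (natDegree_prod_le _ _).trans ?_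
  exact Finset.sum_le_sum fun j _ => hc _ _

lemma aux_minor {K : Type*} [Field K] {m n : Type} [Fintype m] [Fintype n] [DecidableEq n]
    (M : Matrix m n K) (h : LinearIndependent K M.col) :
    ∃ e : n → m, (M.submatrix e id).det ≠ 0 := by
  obtain ⟨κ, a, ha, hsp, hli⟩ := exists_linearIndependent' K M.row
  haveI : Fintype κ := Fintype.ofInjective a ha
  have h1 : M.rank = Fintype.card n := by
    rw [← Matrix.rank_transpose]
    exact LinearIndependent.rank_matrix (M := M.transpose) h
  have h2 : M.rank = Fintype.card κ := by
    rw [Matrix.rank_eq_finrank_span_row, ← hsp, finrank_span_eq_card hli]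
  let φ : n ≃ κ := Fintype.equivOfCardEq (h1.symm.trans h2)
  refine ⟨a ∘ φ, ?_⟩
  have h3 : LinearIndependent K (M.submatrix (a ∘ φ) id).row :=
    hli.comp φ φ.injective
  rw [Matrix.linearIndependent_rows_iff_isUnit, Matrix.isUnit_iff_isUnit_det] at h3
  exact h3.ne_zero

lemma aux_cramer {k : Type*} [Field k] {m n : Type} [Fintype m] [Fintype n] [DecidableEq n]
    (M : Matrix m n k[X]) (c : n → ℕ) (hc : ∀ i j, (M i j).natDegree ≤ c j) (l : n)
    (v : n → RatFunc k) (hv : ∀ i, ∑ j, algebraMap k[X] (RatFunc k) (M i j) * v j = 0)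
    (hl : v l ≠ 0) :
    ∃ w : n → k[X], w l ≠ 0 ∧ (∀ j, (w j).natDegree ≤ ∑ j, c j) ∧ ∀ i, ∑ j, M i j * w j = 0 := by
  classical
  have hinj : Function.Injective (algebraMap k[X] (RatFunc k)) := IsFractionRing.injective _ _
  let col : n → m → RatFunc k := fun j i => algebraMap k[X] (RatFunc k) (M i j)
  obtain ⟨κ, a, ha, hsp, hli⟩ := exists_linearIndependent' (RatFunc k)
    (fun j : {j : n // j ≠ l} => col j)
  haveI : Fintype κ := Fintype.ofInjective a ha
  have hmem : col l ∈ Submodule.span (RatFunc k) (Set.range ((fun j : {j : n // j ≠ l} => col j) ∘ a)) := by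
    rw [hsp]
    have h1 : col l = ∑ j : {j : n // j ≠ l}, (-(v l)⁻¹ * v j) • col j := by
      ext i
      have h2 := hv i
      rw [Fintype.sum_eq_add_sum_subtype_ne _ l] at h2
      simp only [Finset.sum_apply, Pi.smul_apply, smul_eq_mul]
      have h3 : ∑ j : {j : n // j ≠ l}, -(v l)⁻¹ * v j * col j i =
        -(v l)⁻¹ * ∑ j : {j : n // j ≠ l}, algebraMap k[X] (RatFunc k) (M i j) * v j := by
        rw [Finset.mul_sum]
        exact Finset.sum_congr rfl fun j _ => by simp only [col]; ring
      rw [h3, eq_neg_of_add_eq_zero_right h2]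
      simp only [col]
      field_simp
    rw [h1]
    exact Submodule.sum_mem _ fun j _ => Submodule.smul_mem _ _ (Submodule.subset_span ⟨j, rfl⟩)
  obtain ⟨u, hu⟩ := (Submodule.mem_span_range_iff_exists_fun _).1 hmem
  have ⟨e, he⟩ := aux_minor (Matrix.of fun i (b : κ) => col (a b) i) hli
  let N : Matrix κ κ k[X] := M.submatrix e (fun b => (a b : n))
  have hNmap : (Matrix.of fun i (b : κ) => col (a b) i).submatrix e id =
      N.map (algebraMap k[X] (RatFunc k)) := rfl
  have hdet : N.det ≠ 0 := by
    intro h0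
    apply he
    rw [hNmap, ← RingHom.mapMatrix_apply, ← RingHom.map_det, h0, map_zero]
  let r : κ → k[X] := fun b => M (e b) l
  have hcr : ∀ b, algebraMap k[X] (RatFunc k) (N.cramer r b) =
      algebraMap k[X] (RatFunc k) N.det * u b := by
    intro b
    have h1 : (N.map (algebraMap k[X] (RatFunc k))).mulVec u =
        fun b => algebraMap k[X] (RatFunc k) (r b) := by
      ext b'
      have := congrFun hu (e b')
      simp only [Finset.sum_apply, Pi.smul_apply, smul_eq_mul, Function.comp] at this
      rw [Matrix.mulVec, dotProduct]
      simp only [r, col] at this ⊢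
      rw [← this]
      exact Finset.sum_congr rfl fun j _ => by simp [N, mul_comm]
    have h2 : N.map (algebraMap k[X] (RatFunc k)) = (algebraMap k[X] (RatFunc k)).mapMatrix N := rfl
    have h3 : (fun b => algebraMap k[X] (RatFunc k) (N.cramer r b)) =
        (N.map (algebraMap k[X] (RatFunc k))).cramer (fun b => algebraMap k[X] (RatFunc k) (r b)) := by
      ext b
      rw [Matrix.cramer_apply, Matrix.cramer_apply, RingHom.map_det, RingHom.mapMatrix_apply,
        Matrix.map_updateCol]
      rfl
    have h4 := congrFun h3 b
    rw [h4, ← h1, Matrix.cramer_eq_adjugate_mulVec, Matrix.mulVec_mulVec, Matrix.adjugate_mul,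
      Matrix.smul_mulVec, Matrix.one_mulVec, RingHom.map_det, ← h2]
    rfl
  have hne : ∀ b, (a b : n) ≠ l := fun b => (a b).2
  have ha' : Function.Injective (fun b => (a b : n)) := Subtype.val_injective.comp ha
  have hsum : ∀ f : κ → ℕ, (∀ b, f b ≤ c (a b)) → ∑ b, f b ≤ ∑ j, c j := by
    intro f hf
    calc ∑ b, f b ≤ ∑ b, c (a b) := Finset.sum_le_sum fun b _ => hf b
      _ = ∑ j ∈ Finset.univ.image (fun b => (a b : n)), c j := by
        rw [Finset.sum_image (fun x _ y _ h => ha' h)]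
      _ ≤ _ := Finset.sum_le_sum_of_subset (Finset.subset_univ _)
  let w : n → k[X] := fun j => if j = l then N.det else - ∑ b, if (a b : n) = j then N.cramer r b else 0
  have hwl : w l = N.det := by simp [w]
  refine ⟨w, hwl ▸ hdet, ?_, ?_⟩
  · intro j
    by_cases hj : j = l
    · subst hj; rw [hwl]
      exact (aux_det_deg N (fun b => c (a b)) fun i b => hc _ _).trans (hsum _ fun b => le_rfl)
    · simp only [w, if_neg hj, natDegree_neg]
      apply natDegree_sum_le_of_forall_le
      intro b _
      split_ifs with hb
      swap
      · simp
      rw [Matrix.cramer_apply]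
      refine (aux_det_deg _ (fun b' => if b' = b then c l else c (a b')) ?_).trans ?_
      · intro i b'
        rw [Matrix.updateCol_apply]
        split_ifs with h
        · exact hc _ _
        · exact hc _ _
      · rw [← Finset.add_sum_erase _ _ (Finset.mem_univ b)]
        simp only [if_true]
        have h5 : ∑ x ∈ Finset.univ.erase b, (if x = b then c l else c (a x)) =
            ∑ x ∈ Finset.univ.erase b, c (a x) :=
          Finset.sum_congr rfl fun x hx => by rw [if_neg (Finset.ne_of_mem_erase hx)]
        rw [h5]
        have h6 : ∑ x ∈ Finset.univ.erase b, c (a x) =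
            ∑ j ∈ (Finset.univ.erase b).image (fun b => (a b : n)), c j := by
          rw [Finset.sum_image (fun x _ y _ h => ha' h)]
        rw [h6, ← Finset.add_sum_erase Finset.univ c (Finset.mem_univ l)]
        refine Nat.add_le_add_left (Finset.sum_le_sum_of_subset ?_) _
        intro x hx
        obtain ⟨b', _, rfl⟩ := Finset.mem_image.1 hx
        exact Finset.mem_erase.2 ⟨hne b', Finset.mem_univ _⟩
  · intro i
    rw [Fintype.sum_eq_add_sum_subtype_ne _ l, hwl]
    have h7 : ∑ j : {j // j ≠ l}, M i j * w j = - ∑ b, M i (a b) * N.cramer r b := by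
      calc ∑ j : {j // j ≠ l}, M i j * w j
          = ∑ j : {j // j ≠ l}, - ∑ b, (if a b = j then M i (a b) * N.cramer r b else 0) := by
            refine Finset.sum_congr rfl fun j _ => ?_
            simp only [w, if_neg j.2, mul_neg, Finset.mul_sum]
            congr 1
            refine Finset.sum_congr rfl fun b _ => ?_
            by_cases h : a b = j
            · simp [h]
            · have : (a b : n) ≠ j := fun h' => h (Subtype.ext h')
              simp [h, this]
        _ = _ := by
            rw [Finset.sum_neg_distrib, Finset.sum_comm]
            simp
    rw [h7]
    apply hinj
    have h8 := congrFun hu i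
    simp only [Finset.sum_apply, Pi.smul_apply, smul_eq_mul, Function.comp, col] at h8
    rw [map_add, map_neg, map_mul, map_sum, map_zero, ← h8, Finset.sum_mul]
    simp only [map_mul, hcr]
    rw [← sub_eq_add_neg, sub_eq_zero]
    exact Finset.sum_congr rfl fun b _ => by ring

lemma swap_coeff_coeff {k : Type*} [Field k] (Q : k[X][X]) (i j : ℕ) :
    ((Bivariate.swap Q).coeff j).coeff i = (Q.coeff i).coeff j := by
  induction Q using Polynomial.induction_on' with
  | add p q hp hq => simp [hp, hq]
  | monomial n f =>
    induction f using Polynomial.induction_on' with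
    | add p q hp hq => simp [hp, hq]
    | monomial m r =>
      rw [Bivariate.swap_monomial_monomial]
      simp only [coeff_monomial]
      split_ifs <;> simp_all [coeff_monomial]

lemma degX_le_iff {k : Type*} [Field k] (Q : k[X][X]) (d : ℕ) :
    degX Q ≤ d ↔ ∀ i, (Q.coeff i).natDegree ≤ d := by
  rw [degX, Finset.sup_le_iff]
  refine ⟨fun h i => ?_, fun h i _ => h i⟩
  by_cases hi : i ∈ Q.support
  · exact h i hi
  · rw [notMem_support_iff.1 hi]; simp

lemma degX_eq {k : Type*} [Field k] (Q : k[X][X]) :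
    degX Q = (Bivariate.swap Q).natDegree := by
  apply eq_of_forall_ge_iff
  intro d
  rw [degX_le_iff, natDegree_le_iff_coeff_eq_zero]
  simp only [natDegree_le_iff_coeff_eq_zero, Polynomial.ext_iff (p := Polynomial.coeff _ _),
    swap_coeff_coeff, coeff_zero]
  exact ⟨fun h N hN i => h i N hN, fun h i N hN => h N hN i⟩

lemma degX_mul {k : Type*} [Field k] {A B : k[X][X]} (hA : A ≠ 0) (hB : B ≠ 0) :
    degX (A * B) = degX A + degX B := by
  simp only [degX_eq, map_mul]
  rw [natDegree_mul] <;> simpa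

lemma degX_mul_le {k : Type*} [Field k] (A B : k[X][X]) :
    degX (A * B) ≤ degX A + degX B := by
  simp only [degX_eq, map_mul]
  exact natDegree_mul_le

lemma degX_sub_le {k : Type*} [Field k] (A B : k[X][X]) (d : ℕ) (hA : degX A ≤ d)
    (hB : degX B ≤ d) : degX (A - B) ≤ d := by
  rw [degX_eq] at *
  rw [map_sub]
  exact (natDegree_sub_le _ _).trans (max_le hA hB)

lemma degX_add_le {k : Type*} [Field k] (A B : k[X][X]) (d : ℕ) (hA : degX A ≤ d)
    (hB : degX B ≤ d) : degX (A + B) ≤ d := by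
  rw [degX_eq] at *
  rw [map_add]
  exact (natDegree_add_le _ _).trans (max_le hA hB)

lemma degX_pow_le {k : Type*} [Field k] (A : k[X][X]) (n : ℕ) :
    degX (A ^ n) ≤ n * degX A := by
  simp only [degX_eq, map_pow]
  exact natDegree_pow_le

lemma degX_derivative_le {k : Type*} [Field k] (A : k[X][X]) :
    degX (derivative A) ≤ degX A := by
  rw [degX_le_iff]
  intro i
  rw [coeff_derivative]
  refine natDegree_mul_le.trans ?_
  have h1 : ((i : k[X]) + 1).natDegree = 0 := by
    have : ((i : k[X]) + 1) = ((i + 1 : ℕ) : k[X]) := by push_cast; rfl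
    rw [this, natDegree_natCast]
  rw [h1, add_zero]
  exact (degX_le_iff A _).1 le_rfl _

lemma coeff_derivX {k : Type*} [Field k] (A : k[X][X]) (i : ℕ) :
    (derivX A).coeff i = derivative (A.coeff i) := by
  rw [derivX, Polynomial.sum, finset_sum_coeff]
  simp only [coeff_C_mul, coeff_X_pow]
  rw [Finset.sum_eq_single i]
  · simp
  · intro j _ hj; simp [hj.symm]
  · intro hi; rw [notMem_support_iff.1 hi]; simp

lemma degX_derivX_le {k : Type*} [Field k] (A : k[X][X]) :
    degX (derivX A) ≤ degX A := by
  rw [degX_le_iff]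
  intro i
  rw [coeff_derivX]
  exact (natDegree_derivative_le _).trans ((Nat.sub_le _ _).trans ((degX_le_iff A _).1 le_rfl _))

lemma natDegree_derivX_le {k : Type*} [Field k] (A : k[X][X]) :
    (derivX A).natDegree ≤ A.natDegree := by
  rw [natDegree_le_iff_coeff_eq_zero]
  intro N hN
  rw [coeff_derivX, coeff_eq_zero_of_natDegree_lt hN, derivative_zero]

lemma derivX_eq {k : Type*} [Field k] (A : k[X][X]) :
    derivX A = Bivariate.swap (derivative (Bivariate.swap A)) := by
  ext i j
  rw [coeff_derivX, swap_coeff_coeff, coeff_derivative, coeff_derivative]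
  have : ((j : k[X]) + 1) = C ((j : k) + 1) := by simp
  rw [this, coeff_mul_C, swap_coeff_coeff]

lemma derivX_mul {k : Type*} [Field k] (A B : k[X][X]) :
    derivX (A * B) = A * derivX B + B * derivX A := by
  simp only [derivX_eq, map_mul, derivative_mul, map_add, Bivariate.swap_swap_apply]
  ring

/-- closure property -/
lemma dvd_log_mul {R : Type*} [CommRing R] (δ : R → R) (hδ : ∀ a b, δ (a * b) = a * δ b + b * δ a)
    (S U V : R) (hU : U ∣ S * δ U) (hV : V ∣ S * δ V) : U * V ∣ S * δ (U * V) := by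
  rw [hδ]
  obtain ⟨u, hu⟩ := hU
  obtain ⟨v, hv⟩ := hV
  exact ⟨u + v, by linear_combination V * hu + U * hv⟩

lemma dvd_log_pow {R : Type*} [CommRing R] (δ : R → R) (hδ : ∀ a b, δ (a * b) = a * δ b + b * δ a)
    (S U : R) (hU : U ∣ S * δ U) (n : ℕ) : U ^ n ∣ S * δ (U ^ n) := by
  induction n with
  | zero => simp
  | succ n ih => rw [pow_succ]; exact dvd_log_mul δ hδ _ _ _ ih hU

lemma dvd_log_prod {R : Type*} [CommRing R] (δ : R → R) (hδ : ∀ a b, δ (a * b) = a * δ b + b * δ a)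
    (S : R) (m : ℕ) (U : ℕ → R) (hU : ∀ i < m, U i ∣ S * δ (U i)) :
    (∏ i ∈ Finset.range m, U i) ∣ S * δ (∏ i ∈ Finset.range m, U i) := by
  induction m with
  | zero => simp
  | succ n ih =>
    rw [Finset.prod_range_succ]
    exact dvd_log_mul δ hδ _ _ _ (ih fun i hi => hU i (by omega)) (hU n (by omega))

lemma eq_yToXY_of_degX {k : Type*} [Field k] (A : k[X][X]) (h : degX A = 0) :
    ∃ s : k[X], A = yToXY s := by
  refine ⟨(Bivariate.swap A).coeff 0, ?_⟩
  rw [degX_eq] at h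
  rw [yToXY, coe_mapRingHom, ← Bivariate.swap_C, ← eq_C_of_natDegree_eq_zero h,
    Bivariate.swap_swap_apply]

lemma degX_yToXY {k : Type*} [Field k] (s : k[X]) : degX (yToXY s) = 0 := by
  rw [degX_eq, yToXY, coe_mapRingHom, Bivariate.swap_map_C, natDegree_C]

lemma IsDeriv.div {F : Type*} [Field F] {D : F → F} (hD : IsDeriv D) (a b : F) (hb : b ≠ 0) :
    D (a / b) = (D a * b - a * D b) / b ^ 2 := by
  have h := hD.2 (a / b) b
  rw [div_mul_cancel₀ _ hb] at h
  rw [h]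
  field_simp
  ring

lemma toF_injective {k : Type*} [Field k] : Function.Injective (toF (k := k)) := by
  rw [toF, RingHom.coe_comp]
  refine (IsFractionRing.injective _ _).comp ?_
  exact Polynomial.map_injective _ (IsFractionRing.injective _ _)

lemma kyToF_injective {k : Type*} [Field k] : Function.Injective (kyToF (k := k)) :=
  IsFractionRing.injective _ _

lemma toKy_injective {k : Type*} [Field k] : Function.Injective (toKy (k := k)) :=
  Polynomial.map_injective _ (IsFractionRing.injective _ _)

lemma toF_eq {k : Type*} [Field k] (A : k[X][X]) : toF A = kyToF (toKy A) := rfl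

lemma toKy_derivative {k : Type*} [Field k] (A : k[X][X]) :
    derivative (toKy A) = toKy (derivative A) := by
  simp [toKy, derivative_map]

lemma aux_cramer_poly {k : Type*} [Field k] {n : Type} [Fintype n] [DecidableEq n]
    (F : n → k[X][X]) (c : n → ℕ) (hc : ∀ j, degX (F j) ≤ c j) (l : n)
    (v : n → RatFunc k) (hv : ∑ j, C (v j) * toKy (F j) = 0) (hl : v l ≠ 0) :
    ∃ w : n → k[X], w l ≠ 0 ∧ (∀ j, (w j).natDegree ≤ ∑ j, c j) ∧ ∑ j, C (w j) * F j = 0 := by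
  let N := (Finset.univ.sup fun j => (F j).natDegree) + 1
  have hN : ∀ j, (F j).natDegree < N := fun j =>
    Nat.lt_succ_of_le (Finset.le_sup (f := fun j => (F j).natDegree) (Finset.mem_univ j))
  obtain ⟨w, h1, h2, h3⟩ := aux_cramer (Matrix.of fun (i : Fin N) j => (F j).coeff i) c
    (fun i j => (degX_le_iff _ _).1 (hc j) _) l v (by
      intro i
      have := congrArg (fun p => p.coeff (i : ℕ)) hv
      simp only [finset_sum_coeff, coeff_C_mul, toKy, coe_mapRingHom, coeff_map, coeff_zero] at this
      rw [← this]
      exact Finset.sum_congr rfl fun j _ => by simp [mul_comm]) hl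
  refine ⟨w, h1, h2, ?_⟩
  ext1 i
  rw [finset_sum_coeff, coeff_zero]
  simp only [coeff_C_mul]
  by_cases hi : i < N
  · rw [← h3 ⟨i, hi⟩]
    exact Finset.sum_congr rfl fun j _ => by simp [mul_comm]
  · refine Finset.sum_eq_zero fun j _ => ?_
    rw [coeff_eq_zero_of_natDegree_lt ((hN j).trans_le (not_lt.1 hi)), mul_zero]

lemma degX_quot_le {k : Type*} [Field k] (G b S b' : k[X][X]) (hb : b ≠ 0)
    (hb' : degX b' ≤ degX b) (h : S * b' = b * G) : degX G ≤ degX S := by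
  by_cases hG : G = 0
  · rw [hG]; simp [degX]
  have h1 := degX_mul hb hG
  rw [← h] at h1
  have := degX_mul_le S b'
  omega

lemma natDegree_quot_le {k : Type*} [Field k] (G b S b' : k[X][X]) (hb : b ≠ 0)
    (hb' : b'.natDegree ≤ b.natDegree) (h : S * b' = b * G) : G.natDegree ≤ S.natDegree := by
  by_cases hG : G = 0
  · rw [hG]; simp
  have h1 := natDegree_mul hb hG
  rw [← h] at h1
  have := natDegree_mul_le (p := S) (q := b')
  omega

lemma Dx_iter {k : Type*} [Field k] (P Q Ts : k[X][X]) (hQ : Q ≠ 0) (hTs : Ts ≠ 0)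
    (hPx : degX P ≤ degX Q) (hPy : P.natDegree < Q.natDegree)
    (hlog : Q ∣ Ts * derivX Q)
    (Dx : RatFunc (RatFunc k) → RatFunc (RatFunc k)) (hDx : IsDeriv Dx)
    (hDxval : ∀ A : Polynomial (Polynomial k), Dx (toF A) = toF (derivX A)) (i : ℕ) :
    ∃ p : k[X][X], Dx^[i] (toF P / toF Q) = toF p / (toF Q * toF Ts ^ i) ∧
      degX p ≤ degX Q + i * degX Ts ∧ p.natDegree < Q.natDegree + i * Ts.natDegree := by
  induction i with
  | zero => exact ⟨P, by simp, by simpa, by simpa⟩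
  | succ i ih =>
    obtain ⟨p, h1, h2, h3⟩ := ih
    obtain ⟨G, hG⟩ : Q * Ts ^ i ∣ Ts * derivX (Q * Ts ^ i) :=
      dvd_log_mul derivX derivX_mul _ _ _ hlog
        (dvd_log_pow derivX derivX_mul _ _ (Dvd.intro _ rfl) i)
    have hb : Q * Ts ^ i ≠ 0 := mul_ne_zero hQ (pow_ne_zero _ hTs)
    have hGx := degX_quot_le G _ _ _ hb (degX_derivX_le _) hG
    have hGy := natDegree_quot_le G _ _ _ hb (natDegree_derivX_le _) hG
    refine ⟨Ts * derivX p - p * G, ?_, ?_, ?_⟩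
    · rw [Function.iterate_succ_apply', h1, ← map_pow, ← map_mul]
      have hbF : toF (Q * Ts ^ i) ≠ 0 := (map_ne_zero_iff _ toF_injective).2 hb
      have hTF : toF Ts ≠ 0 := (map_ne_zero_iff _ toF_injective).2 hTs
      rw [hDx.div _ _ hbF, hDxval, hDxval]
      have hGF := congrArg toF hG
      rw [map_mul, map_mul (f := toF) (Q * Ts ^ i)] at hGF
      have h4 : toF Q * toF Ts ^ (i + 1) = toF (Q * Ts ^ i) * toF Ts := by
        rw [map_mul, map_pow]; ring
      rw [h4, div_eq_div_iff (pow_ne_zero _ hbF) (mul_ne_zero hbF hTF), map_sub, map_mul toF Ts, map_mul toF p]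
      linear_combination (-toF p * toF (Q * Ts ^ i)) * hGF
    · apply degX_sub_le
      · have := degX_mul_le Ts (derivX p)
        have := degX_derivX_le p
        rw [add_mul, one_mul]; omega
      · have := degX_mul_le p G
        rw [add_mul, one_mul]; omega
    · have e1 := natDegree_mul_le (p := Ts) (q := derivX p)
      have e2 := natDegree_derivX_le p
      have e3 := natDegree_mul_le (p := p) (q := G)
      have e4 := natDegree_sub_le (Ts * derivX p) (p * G)
      rw [add_mul, one_mul]
      omega

lemma Dy_quot {k : Type*} [Field k]
    (Dy : RatFunc (RatFunc k) → RatFunc (RatFunc k)) (hDy : IsDeriv Dy)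
    (hDyval : ∀ A : Polynomial (RatFunc k), Dy (kyToF A) = kyToF (Polynomial.derivative A))
    (A B : (RatFunc k)[X]) (hB : B ≠ 0) :
    Dy (kyToF A / kyToF B) = kyToF (derivative A * B - A * derivative B) / kyToF (B ^ 2) := by
  rw [hDy.div _ _ ((map_ne_zero_iff _ kyToF_injective).2 hB), hDyval, hDyval]
  simp only [map_sub, map_mul, map_pow]

lemma sum_numer {k : Type*} [Field k] (Q Ts : k[X][X]) (hQ : Q ≠ 0) (hTs : Ts ≠ 0) (ρ : ℕ)
    (p : ℕ → k[X][X]) (η : Fin (ρ + 1) → RatFunc k) :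
    ∑ i : Fin (ρ + 1), ratToF (η i) * (toF (p i) / (toF Q * toF Ts ^ (i : ℕ))) =
      kyToF (∑ i : Fin (ρ + 1), C (η i) * toKy (p i * Ts ^ (ρ - i))) /
        kyToF (toKy (Q * Ts ^ ρ)) := by
  have hQF : toF Q ≠ 0 := (map_ne_zero_iff _ toF_injective).2 hQ
  have hTF : toF Ts ≠ 0 := (map_ne_zero_iff _ toF_injective).2 hTs
  rw [map_sum, Finset.sum_div]
  refine Finset.sum_congr rfl fun i _ => ?_
  rw [map_mul, ← toF_eq, ← toF_eq, map_mul, map_mul, map_pow, map_pow]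
  have h1 : kyToF (C (η i)) = ratToF (η i) := rfl
  have h2 : toF Ts ^ ρ = toF Ts ^ (i : ℕ) * toF Ts ^ (ρ - i) := by
    rw [← pow_add]; congr 1; omega
  rw [h1, h2]
  field_simp

lemma main_aux {k : Type*} [Field k] [CharZero k]
    (P Q : Polynomial (Polynomial k)) (hQ : Q ≠ 0)
    (hPQdeg : P.natDegree < Q.natDegree)
    (hPx : degX P ≤ degX Q)
    (Qs Qneg Ts : Polynomial (Polynomial k))
    (hsqf : Squarefree Qs)
    (hQneg : Q = Qs * Qneg) (hTsQ : Ts ∣ Qs)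
    (hnegdvd : Qneg ∣ Qs * derivative Qneg)
    (hlog : Q ∣ Ts * derivX Q)
    (Dy : RatFunc (RatFunc k) → RatFunc (RatFunc k)) (hDy : IsDeriv Dy)
    (hDyval : ∀ A : Polynomial (RatFunc k), Dy (kyToF A) = kyToF (Polynomial.derivative A))
    (Dx : RatFunc (RatFunc k) → RatFunc (RatFunc k)) (hDx : IsDeriv Dx)
    (hDxval : ∀ A : Polynomial (Polynomial k), Dx (toF A) = toF (derivX A))
    (ρ : ℕ)
    (hex : ∃ ηr : Fin (ρ + 1) → RatFunc k, ηr (Fin.last ρ) ≠ 0 ∧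
      ∃ g : RatFunc (RatFunc k),
        ∑ i : Fin (ρ + 1), ratToF (ηr i) * Dx^[(i : ℕ)] (toF P / toF Q) = Dy g)
    (nx β : ℕ)
    (hnx : nx = degX Q + ρ * degX Ts)
    (hβ : β = Qneg.natDegree + ρ * Ts.natDegree) :
    ∃ η : Fin (ρ + 1) → Polynomial k, η (Fin.last ρ) ≠ 0 ∧
      (∀ i : Fin (ρ + 1), (η i).natDegree ≤ nx * (ρ + 1) + degX Q * (β + 1)) ∧
      ∃ z : Polynomial (Polynomial k),
        degX z ≤ nx * (ρ + 1) + degX Q * (β + 1) ∧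
        z.natDegree ≤ β ∧
        ∑ i : Fin (ρ + 1),
            toF (Polynomial.C (η i)) * Dx^[(i : ℕ)] (toF P / toF Q) =
          Dy (toF z / (toF Qneg * toF Ts ^ ρ)) := by
  have hQs0 : Qs ≠ 0 := hsqf.ne_zero
  have hneg0 : Qneg ≠ 0 := by rintro rfl; simp at hQneg; exact hQ hQneg
  have hTs0 : Ts ≠ 0 := ne_zero_of_dvd_ne_zero hQs0 hTsQ
  choose p hp1 hp2 hp3 using Dx_iter P Q Ts hQ hTs0 hPx hPQdeg hlog Dx hDx hDxval
  -- the denominator of the certificate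
  set W : k[X][X] := Qneg * Ts ^ ρ with hWdef
  have hW0 : W ≠ 0 := mul_ne_zero hneg0 (pow_ne_zero _ hTs0)
  have hWdeg : W.natDegree = β := by
    rw [hWdef, natDegree_mul hneg0 (pow_ne_zero _ hTs0), natDegree_pow, hβ]
  have hQW : Q * Ts ^ ρ = Qs * W := by rw [hQneg, hWdef]; ring
  have hderm : ∀ a b : k[X][X], derivative (a * b) = a * derivative b + b * derivative a := by
    intro a b; rw [derivative_mul]; ring
  obtain ⟨E, hE⟩ : W ∣ Qs * derivative W :=
    dvd_log_mul (fun a => derivative a) hderm _ _ _ hnegdvd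
      (dvd_log_pow (fun a => derivative a) hderm _ _ (hTsQ.mul_right _) ρ)
  have hEx : degX E ≤ degX Qs := degX_quot_le E _ _ _ hW0 (degX_derivative_le _) hE
  have hQsx : degX Qs ≤ degX Q := by
    rw [hQneg, degX_mul hQs0 hneg0]; omega
  have hWK : toKy W ≠ 0 := (map_ne_zero_iff _ toKy_injective).2 hW0
  have hQsK : toKy Qs ≠ 0 := (map_ne_zero_iff _ toKy_injective).2 hQs0
  have hEK := congrArg toKy hE
  rw [map_mul toKy Qs, map_mul toKy W, ← toKy_derivative] at hEK
  -- the Wronskian type identity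
  have hcert : ∀ (N z : (RatFunc k)[X]),
      kyToF N / kyToF (toKy (Q * Ts ^ ρ)) = Dy (kyToF z / kyToF (toKy W)) ↔
        N = toKy Qs * derivative z - toKy E * z := by
    intro N z
    rw [Dy_quot Dy hDy hDyval _ _ hWK, hQW, map_mul toKy,
      div_eq_div_iff ((map_ne_zero_iff _ kyToF_injective).2 (mul_ne_zero hQsK hWK))
        ((map_ne_zero_iff _ kyToF_injective).2 (pow_ne_zero _ hWK)),
      ← map_mul, ← map_mul, kyToF_injective.eq_iff]
    constructor
    · intro h
      apply mul_right_cancel₀ (pow_ne_zero 2 hWK)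
      linear_combination h - z * toKy W * hEK
    · intro h
      rw [h]
      linear_combination z * toKy W * hEK
  let F : Fin (ρ + 1) ⊕ Fin (β + 1) → k[X][X] :=
    Sum.elim (fun i => p i * Ts ^ (ρ - i))
      (fun j => E * X ^ (j : ℕ) - Qs * derivative (X ^ (j : ℕ)))
  let c : Fin (ρ + 1) ⊕ Fin (β + 1) → ℕ := Sum.elim (fun _ => nx) (fun _ => degX Q)
  have hcsum : ∑ j, c j = nx * (ρ + 1) + degX Q * (β + 1) := by
    simp [c, Fintype.sum_sum_type, mul_comm]
  have hXpow : ∀ j : ℕ, degX (X ^ j : k[X][X]) = 0 := by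
    intro j
    rw [show (X ^ j : k[X][X]) = yToXY (X ^ j) by simp [yToXY], degX_yToXY]
  have hc : ∀ j, degX (F j) ≤ c j := by
    rintro (i | j)
    · simp only [F, c, Sum.elim_inl]
      have e1 := degX_mul_le (p i) (Ts ^ (ρ - i))
      have e2 := degX_pow_le Ts (ρ - i)
      have e3 := hp2 i
      have e4 : (i : ℕ) * degX Ts + (ρ - i) * degX Ts = ρ * degX Ts := by
        rw [← add_mul]; congr 1; omega
      omega
    · simp only [F, c, Sum.elim_inr]
      apply degX_sub_le
      · have := degX_mul_le E (X ^ (j : ℕ))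
        rw [hXpow] at this
        omega
      · have h1 := degX_mul_le Qs (derivative (X ^ (j : ℕ)))
        have h2 := degX_derivative_le (X ^ (j : ℕ) : k[X][X])
        rw [hXpow] at h2
        omega
  obtain ⟨ηr, hη0, g, hg⟩ := hex
  simp only [hp1] at hg
  rw [sum_numer Q Ts hQ hTs0] at hg
  set N := ∑ i : Fin (ρ + 1), C (ηr i) * toKy (p i * Ts ^ (ρ - i)) with hN
  have hNdeg : N.degree < (toKy Qs * toKy W).degree := by
    have hK : ∀ A : k[X][X], (toKy A).natDegree = A.natDegree := fun A =>
      natDegree_map_eq_of_injective (IsFractionRing.injective _ _) A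
    apply degree_lt_degree
    rw [← map_mul, hK, ← hQW, natDegree_mul hQ (pow_ne_zero _ hTs0), natDegree_pow]
    refine Nat.lt_of_le_pred (by omega) (natDegree_sum_le_of_forall_le _ _ fun i _ => ?_)
    refine (natDegree_C_mul_le _ _).trans ?_
    rw [hK]
    have e1 := natDegree_mul_le (p := p i) (q := Ts ^ (ρ - (i : ℕ)))
    have e2 := natDegree_pow_le (p := Ts) (n := ρ - (i : ℕ))
    have e3 := hp3 i
    have e4 : (i : ℕ) * Ts.natDegree + (ρ - i) * Ts.natDegree = ρ * Ts.natDegree := by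
      rw [← add_mul]; congr 1; omega
    rw [Nat.pred_eq_sub_one]
    omega
  have hgAB : kyToF g.num / kyToF g.denom = g := RatFunc.num_div_denom g
  have hB0 : g.denom ≠ 0 := RatFunc.denom_ne_zero g
  have hrel : (toKy Qs * toKy W) * (derivative g.num * g.denom - g.num * derivative g.denom) =
      N * g.denom ^ 2 := by
    rw [← hgAB, Dy_quot Dy hDy hDyval _ _ hB0, hQW, map_mul toKy,
      div_eq_div_iff ((map_ne_zero_iff _ kyToF_injective).2 (mul_ne_zero hQsK hWK))
        ((map_ne_zero_iff _ kyToF_injective).2 (pow_ne_zero _ hB0)),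
      ← map_mul, ← map_mul, kyToF_injective.eq_iff] at hg
    linear_combination -hg
  obtain ⟨z, hzdeg, hz⟩ := aux_form g.num g.denom N (toKy Qs) (toKy W) hB0 hWK
    (RatFunc.isCoprime_num_denom g) (aux_sqf Qs hsqf) hNdeg hrel
  have hgz : g = kyToF z / kyToF (toKy W) := by
    conv_lhs => rw [← hgAB]
    rw [div_eq_div_iff ((map_ne_zero_iff _ kyToF_injective).2 hB0)
      ((map_ne_zero_iff _ kyToF_injective).2 hWK), ← map_mul, ← map_mul, hz]
  rw [hgz, hcert] at hg
  have hzdeg' : z.natDegree < β + 1 := by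
    have hK : (toKy W).natDegree = W.natDegree :=
      natDegree_map_eq_of_injective (IsFractionRing.injective _ _) W
    omega
  have hzsum : z = ∑ j : Fin (β + 1), C (z.coeff j) * X ^ (j : ℕ) := by
    conv_lhs => rw [z.as_sum_range_C_mul_X_pow' hzdeg']
    rw [Finset.sum_range]
  obtain ⟨w, hw0, hwdeg, hw⟩ := aux_cramer_poly F c hc (Sum.inl (Fin.last ρ))
    (Sum.elim ηr fun j => z.coeff j) (by
      rw [Fintype.sum_sum_type]
      simp only [Sum.elim_inl, Sum.elim_inr, F]
      rw [← hN, hg]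
      conv_lhs => enter [1]; rw [hzsum]
      rw [derivative_sum, Finset.mul_sum, Finset.mul_sum, ← Finset.sum_sub_distrib,
        ← Finset.sum_add_distrib]
      refine Finset.sum_eq_zero fun j _ => ?_
      rw [map_sub toKy, map_mul toKy E, map_mul toKy Qs, ← toKy_derivative, map_pow toKy,
        show toKy (X : k[X][X]) = X by simp [toKy], derivative_C_mul]
      ring) (by simpa using hη0)
  rw [hcsum] at hwdeg
  refine ⟨fun i => w (Sum.inl i), hw0, fun i => hwdeg _,
    ∑ j : Fin (β + 1), C (w (Sum.inr j)) * X ^ (j : ℕ), ?_, ?_, ?_⟩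
  · rw [degX_le_iff]
    intro i
    rw [finset_sum_coeff]
    apply natDegree_sum_le_of_forall_le
    intro j _
    rw [coeff_C_mul, coeff_X_pow]
    split_ifs
    · rw [mul_one]; exact hwdeg _
    · simp
  · apply natDegree_sum_le_of_forall_le
    intro j _
    refine (natDegree_C_mul_X_pow_le _ _).trans (by omega)
  · simp only [hp1]
    have h1 : ∀ a : k[X], toF (C a) = ratToF (algebraMap k[X] (RatFunc k) a) := by
      intro a; simp [toF, ratToF]
    simp only [h1]
    rw [sum_numer Q Ts hQ hTs0, ← map_pow, ← map_mul, toF_eq, toF_eq, ← hWdef, hcert,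
      toKy_derivative, ← map_mul, ← map_mul, ← map_sub]
    have h2 : ∀ a : k[X], C (algebraMap k[X] (RatFunc k) a) = toKy (C a) := by
      intro a; simp [toKy]
    simp only [h2, ← map_mul]
    rw [← map_sum]
    congr 1
    rw [Fintype.sum_sum_type] at hw
    simp only [F, Sum.elim_inl, Sum.elim_inr] at hw
    rw [derivative_sum, Finset.mul_sum, Finset.mul_sum, ← Finset.sum_sub_distrib,
      eq_neg_of_add_eq_zero_left hw, ← Finset.sum_neg_distrib]
    refine Finset.sum_congr rfl fun j _ => ?_
    rw [derivative_C_mul]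
    ring

theorem stmt_15 {k : Type*} [Field k] [CharZero k]
    (P Q : Polynomial (Polynomial k))
    (hP : P ≠ 0) (hQ : Q ≠ 0)
    (hPQdeg : P.degree < Q.degree)
    (hPQcop : IsRelPrime P Q)
    (hQprimY : Q.IsPrimitive)
    (hPx : degX P ≤ degX Q)
    (m : ℕ) (hm : 0 < m) (q : Polynomial k) (Qi : ℕ → Polynomial (Polynomial k))
    (hfac : Q = Polynomial.C q * ∏ i ∈ Finset.range m, Qi i ^ (i + 1))
    (hQiprim : ∀ i < m, (Qi i).IsPrimitive)
    (hQisqf : ∀ i < m, Squarefree (Qi i))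
    (hQicop : ∀ i < m, ∀ j < m, i ≠ j → IsRelPrime (Qi i) (Qi j))
    (hQim : 0 < (Qi (m - 1)).natDegree)
    (Qs Qneg : Polynomial (Polynomial k))
    (hQs : Qs = ∏ i ∈ Finset.range m, Qi i)
    (hQneg : Q = Qs * Qneg)
    (Dy : RatFunc (RatFunc k) → RatFunc (RatFunc k)) (hDy : IsDeriv Dy)
    (hDyval : ∀ A : Polynomial (RatFunc k), Dy (kyToF A) = kyToF (Polynomial.derivative A))
    (Dx : RatFunc (RatFunc k) → RatFunc (RatFunc k)) (hDx : IsDeriv Dx)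
    (hDxval : ∀ A : Polynomial (Polynomial k), Dx (toF A) = toF (derivX A))
    (t : Polynomial k) (T : Polynomial (Polynomial k))
    (hQtT : Q = yToXY t * T)
    (hTprim : ∀ s : Polynomial k, yToXY s ∣ T → IsUnit s)
    (ts : Polynomial k) (Ts : Polynomial (Polynomial k))
    (hts : ts ∣ t) (hTs : Ts ∣ T)
    (hsplit : Qs = yToXY ts * Ts)
    -- `ρ` is the minimal order of a telescoper for `f`
    (ρ : ℕ)
    (hex : ∃ ηr : Fin (ρ + 1) → RatFunc k, ηr (Fin.last ρ) ≠ 0 ∧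
      ∃ g : RatFunc (RatFunc k),
        ∑ i : Fin (ρ + 1), ratToF (ηr i) * Dx^[(i : ℕ)] (toF P / toF Q) = Dy g)
    (hminρ : ∀ ρ' < ρ, ¬ ∃ ηr : Fin (ρ' + 1) → RatFunc k, ηr (Fin.last ρ') ≠ 0 ∧
      ∃ g : RatFunc (RatFunc k),
        ∑ i : Fin (ρ' + 1), ratToF (ηr i) * Dx^[(i : ℕ)] (toF P / toF Q) = Dy g)
    (nx β : ℕ)
    (hnx : nx = degX Q + ρ * degX Ts)
    (hβ : β = Qneg.natDegree + ρ * Ts.natDegree) :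
    ∃ η : Fin (ρ + 1) → Polynomial k, η (Fin.last ρ) ≠ 0 ∧
      (∀ i : Fin (ρ + 1), (η i).natDegree ≤ nx * (ρ + 1) + degX Q * (β + 1)) ∧
      ∃ z : Polynomial (Polynomial k),
        degX z ≤ nx * (ρ + 1) + degX Q * (β + 1) ∧
        z.natDegree ≤ β ∧
        ∑ i : Fin (ρ + 1),
            toF (Polynomial.C (η i)) * Dx^[(i : ℕ)] (toF P / toF Q) =
          Dy (toF z / (toF Qneg * toF Ts ^ ρ)) := by

  have hQs0 : Qs ≠ 0 := by rintro rfl; simp at hQneg; exact hQ hQneg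
  have hsqf : Squarefree Qs := by
    rw [hQs]
    apply Finset.squarefree_prod_of_pairwise_isCoprime
    · intro i hi j hj hij
      simp only [Finset.coe_range, Set.mem_Iio] at hi hj
      exact hQicop i hi j hj hij
    · intro i hi
      exact hQisqf i (Finset.mem_range.1 hi)
  have hqu : IsUnit (Polynomial.C q) :=
    Polynomial.isUnit_C.2 (hQprimY q (hfac ▸ Dvd.intro _ rfl))
  have hQidvd : ∀ i < m, Qi i ∣ Qs := fun i hi => by
    rw [hQs]; exact Finset.dvd_prod_of_mem _ (Finset.mem_range.2 hi)
  have hderm : ∀ a b : k[X][X], derivative (a * b) = a * derivative b + b * derivative a := by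
    intro a b; rw [derivative_mul]; ring
  have hnegeq : Qneg = Polynomial.C q * ∏ i ∈ Finset.range m, Qi i ^ i := by
    apply mul_left_cancel₀ hQs0
    rw [← hQneg, hfac]
    simp only [pow_succ, Finset.prod_mul_distrib, ← hQs]
    ring
  have hnegdvd : Qneg ∣ Qs * derivative Qneg := by
    rw [hnegeq]
    refine dvd_log_mul (fun a => derivative a) hderm _ _ _ hqu.dvd ?_
    refine dvd_log_prod (fun a => derivative a) hderm _ _ _ fun i hi => ?_
    exact dvd_log_pow (fun a => derivative a) hderm _ _ ((hQidvd i hi).mul_right _) i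
  have hQdvd : Q ∣ Qs * derivX Q := by
    rw [hfac]
    refine dvd_log_mul derivX derivX_mul _ _ _ hqu.dvd ?_
    refine dvd_log_prod derivX derivX_mul _ _ _ fun i hi => ?_
    exact dvd_log_pow derivX derivX_mul _ _ ((hQidvd i hi).mul_right _) _
  have hts0 : yToXY ts ≠ 0 := by intro h0; rw [h0, zero_mul] at hsplit; exact hQs0 hsplit
  have ht0 : yToXY t ≠ 0 := by intro h0; rw [h0, zero_mul] at hQtT; exact hQ hQtT
  have hdt : ∀ s : k[X], derivX (yToXY s) = 0 := by
    intro s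
    ext1 i
    rw [coeff_derivX]
    simp [yToXY]
  have hrel : IsRelPrime T (yToXY ts) := by
    intro d hd1 hd2
    obtain ⟨e, he⟩ := hd2
    have hd0 : d ≠ 0 := by rintro rfl; rw [zero_mul] at he; exact hts0 he
    have he0 : e ≠ 0 := by rintro rfl; rw [mul_zero] at he; exact hts0 he
    have h1 := degX_mul hd0 he0
    rw [← he, degX_yToXY] at h1
    obtain ⟨s, rfl⟩ := eq_yToXY_of_degX d (by omega)
    exact (hTprim s hd1).map yToXY
  have hlog : Q ∣ Ts * derivX Q := by
    have h1 : derivX Q = yToXY t * derivX T := by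
      rw [hQtT, derivX_mul, hdt, mul_zero, add_zero]
    obtain ⟨G, hG⟩ := hQdvd
    have h2 : T ∣ yToXY ts * (Ts * derivX T) := by
      refine ⟨G, mul_left_cancel₀ ht0 ?_⟩
      rw [h1, hsplit] at hG
      rw [← mul_assoc (yToXY t) T, ← hQtT, ← hG]
      ring
    obtain ⟨H, hH⟩ := hrel.dvd_of_dvd_mul_left h2
    refine ⟨H, ?_⟩
    rw [h1, hQtT]
    linear_combination yToXY t * hH
  exact main_aux P Q hQ (natDegree_lt_natDegree hP hPQdeg) hPx Qs Qneg Ts hsqf hQneg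
    (hsplit ▸ Dvd.intro_left _ rfl) hnegdvd hlog Dy hDy hDyval Dx hDx hDxval ρ hex nx β hnx hβ
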